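/- Let G be a finite connected simple graph that is not isomorphic to any path graph and not isomorphic to any cycle graph. If the girth of G equals 3, then Δ(G) ≤ 3·res(G) − 4; and if the girth of G is strictly greater than 3 (possibly infinite), then Δ(G) ≤ res(G). -/

import Mathlib

open SimpleGraph

/-- A set `S` of vertices is a resolving set of `G` if every pair of distinct vertices
`x, y` is resolved by some vertex `u ∈ S`, i.e. `d(u,x) ≠ d(u,y)`. -/
def IsResolvingSet {V : Type*} (G : SimpleGraph V) (S : Set V) : Prop :=
  ∀ x y : V, x ≠ y → ∃ u ∈ S, G.dist u x ≠ G.dist u y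

/-- The resolving number of `G`: the minimum `k` such that every `k`-element subset of the
vertex set is a resolving set of `G`. -/
noncomputable def resolvingNumber {V : Type*} [Fintype V] (G : SimpleGraph V) : ℕ :=
  sInf {k | ∀ S : Finset V, S.card = k → IsResolvingSet G ↑S}

/-- Vertices which are all equidistant from two distinct vertices `x` and `y` are fewer than the
resolving number. -/
theorem card_lt_resolvingNumber {V : Type*} [Fintype V] (G : SimpleGraph V) {x y : V}
    (hxy : x ≠ y) (S : Finset V) (hS : ∀ u ∈ S, G.dist u x = G.dist u y) :
    S.card < resolvingNumber G := by
  have hmem : ∀ T : Finset V, T.card = resolvingNumber G → IsResolvingSet G ↑T := by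
    refine Nat.sInf_mem (s := {k | ∀ S : Finset V, S.card = k → IsResolvingSet G ↑S})
      ⟨Fintype.card V + 1, fun T hT => ?_⟩
    have := T.card_le_univ
    omega
  by_contra! h
  obtain ⟨T, hTS, hT⟩ := Finset.exists_subset_card_eq h
  obtain ⟨u, hu, hne⟩ := hmem T hT x y hxy
  exact hne (hS u (hTS hu))

/-- Two neighbours of `v` that are not adjacent are at distance two. -/
theorem dist_eq_two_of_common_neighbor {V : Type*} {G : SimpleGraph V} {v x y : V}
    (hx : G.Adj v x) (hy : G.Adj v y) (hne : x ≠ y) (hxy : ¬ G.Adj x y) : G.dist x y = 2 := by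
  have h2 : G.dist x y ≤ 2 := dist_le (.cons hx.symm (.cons hy .nil))
  have hr : G.Reachable x y := hx.symm.reachable.trans hy.reachable
  have h0 : G.dist x y ≠ 0 := fun h => hne (hr.dist_eq_zero_iff.mp h)
  have h1 : G.dist x y ≠ 1 := fun h => hxy (dist_eq_one_iff_adj.mp h)
  omega

/-- A neighbour of `v` is equidistant from two other neighbours of `v` as soon as it is adjacent
to both or to neither. -/
theorem dist_eq_dist_of_adj_iff {V : Type*} {G : SimpleGraph V} {v u x y : V}
    (hu : G.Adj v u) (hx : G.Adj v x) (hy : G.Adj v y) (hux : u ≠ x) (huy : u ≠ y)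
    (h : G.Adj u x ↔ G.Adj u y) : G.dist u x = G.dist u y := by
  by_cases hux' : G.Adj u x
  · rw [dist_eq_one_iff_adj.mpr hux', dist_eq_one_iff_adj.mpr (h.mp hux')]
  · rw [dist_eq_two_of_common_neighbor hu hx hux hux',
      dist_eq_two_of_common_neighbor hu hy huy (h.not.mp hux')]

/-- A vertex of degree at least three has degree at most `3 * res(G) - 4`. -/
theorem degree_add_four_le {V : Type*} [Fintype V] (G : SimpleGraph V) [DecidableRel G.Adj]
    (v : V) (hv : 3 ≤ G.degree v) : G.degree v + 4 ≤ 3 * resolvingNumber G := by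
  classical
  obtain ⟨T, hTN, hT⟩ := Finset.exists_subset_card_eq hv
  obtain ⟨a, b, c, hab, hac, hbc, rfl⟩ := Finset.card_eq_three.mp hT
  have ha : G.Adj v a := (G.mem_neighborFinset v a).mp (hTN (by simp))
  have hb : G.Adj v b := (G.mem_neighborFinset v b).mp (hTN (by simp))
  have hc : G.Adj v c := (G.mem_neighborFinset v c).mp (hTN (by simp))
  let E (x y : V) : Finset V := {u | u ∈ G.neighborFinset v ∧ G.dist u x = G.dist u y}
  have hE : ∀ x y, x ≠ y → G.Adj v x → G.Adj v y → (E x y).card + 2 ≤ resolvingNumber G := by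
    intro x y hxy hx hy
    have hvE : v ∉ E x y := by simp [E]
    have h := card_lt_resolvingNumber G hxy (insert v (E x y)) fun u hu => by
      rcases Finset.mem_insert.mp hu with rfl | hu
      · rw [dist_eq_one_iff_adj.mpr hx, dist_eq_one_iff_adj.mpr hy]
      · exact (Finset.mem_filter.mp hu).2.2
    rw [Finset.card_insert_of_notMem hvE] at h
    omega
  have hcover : (G.neighborFinset v \ {a, b, c}).card + 1 ≤
      (E a b).card + (E b c).card + (E a c).card := by
    obtain ⟨w, hw, hwE⟩ : ∃ w ∈ ({a, b, c} : Finset V), w ∈ E a b ∪ E b c ∪ E a c := by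
      have h1 := dist_eq_dist_of_adj_iff hc ha hb hac.symm hbc.symm
      have h2 := dist_eq_dist_of_adj_iff ha hb hc hab hac
      have h3 := dist_eq_dist_of_adj_iff hb ha hc hab.symm hbc
      simp only [Finset.mem_insert, Finset.mem_singleton, Finset.mem_union, E,
        Finset.mem_filter, Finset.mem_univ, true_and, mem_neighborFinset]
      rw [G.adj_comm c a, G.adj_comm c b] at h1
      rw [G.adj_comm b a] at h3
      by_cases p : G.Adj a b <;> by_cases q : G.Adj b c <;> by_cases r : G.Adj a c <;>
        simp_all
    have hsub : insert w (G.neighborFinset v \ {a, b, c}) ⊆ E a b ∪ E b c ∪ E a c := by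
      intro u hu
      rcases Finset.mem_insert.mp hu with rfl | hu
      · exact hwE
      · simp only [Finset.mem_sdiff, mem_neighborFinset, Finset.mem_insert,
          Finset.mem_singleton, not_or] at hu
        obtain ⟨hvu, hua, hub, huc⟩ := hu
        have h1 := dist_eq_dist_of_adj_iff hvu ha hb hua hub
        have h2 := dist_eq_dist_of_adj_iff hvu hb hc hub huc
        have h3 := dist_eq_dist_of_adj_iff hvu ha hc hua huc
        simp only [Finset.mem_union, E, Finset.mem_filter, Finset.mem_univ, true_and,
          mem_neighborFinset]
        tauto
    have hwN : w ∉ G.neighborFinset v \ {a, b, c} := by simp [hw]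
    have h := Finset.card_le_card hsub
    rw [Finset.card_insert_of_notMem hwN] at h
    have h1 := Finset.card_union_le (E a b ∪ E b c) (E a c)
    have h2 := Finset.card_union_le (E a b) (E b c)
    omega
  rw [Finset.card_sdiff_of_subset hTN, hT, card_neighborFinset_eq_degree] at hcover
  have := hE a b hab ha hb
  have := hE b c hbc hb hc
  have := hE a c hac ha hc
  omega

/-- In a triangle-free graph, a vertex of degree at least two has degree at most `res(G)`. -/
theorem degree_le_resolvingNumber_of_cliqueFree {V : Type*} [Fintype V] (G : SimpleGraph V)
    [DecidableRel G.Adj] (hG : G.CliqueFree 3) (v : V) (hv : 2 ≤ G.degree v) :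
    G.degree v ≤ resolvingNumber G := by
  classical
  obtain ⟨T, hTN, hT⟩ := Finset.exists_subset_card_eq hv
  obtain ⟨a, b, hab, rfl⟩ := Finset.card_eq_two.mp hT
  have ha : G.Adj v a := (G.mem_neighborFinset v a).mp (hTN (by simp))
  have hb : G.Adj v b := (G.mem_neighborFinset v b).mp (hTN (by simp))
  have hindep : ∀ x y, G.Adj v x → G.Adj v y → ¬ G.Adj x y := fun x y hx hy hxy =>
    hG {v, x, y} (is3Clique_triple_iff.mpr ⟨hx, hy, hxy⟩)
  have hvN : v ∉ G.neighborFinset v \ {a, b} := by simp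
  have h := card_lt_resolvingNumber G hab (insert v (G.neighborFinset v \ {a, b})) fun u hu => by
    rcases Finset.mem_insert.mp hu with rfl | hu
    · rw [dist_eq_one_iff_adj.mpr ha, dist_eq_one_iff_adj.mpr hb]
    · simp only [Finset.mem_sdiff, mem_neighborFinset, Finset.mem_insert,
        Finset.mem_singleton, not_or] at hu
      exact dist_eq_dist_of_adj_iff hu.1 ha hb hu.2.1 hu.2.2
        (iff_of_false (hindep u a hu.1 ha) (hindep u b hu.1 hb))
  rw [Finset.card_insert_of_notMem hvN, Finset.card_sdiff_of_subset hTN, hT,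
    card_neighborFinset_eq_degree] at h
  omega

/-- A graph of girth greater than three is triangle-free. -/
theorem cliqueFree_three_of_three_lt_egirth {V : Type*} {G : SimpleGraph V}
    (h : 3 < G.egirth) : G.CliqueFree 3 := by
  classical
  intro s hs
  obtain ⟨u, w, hw, hlen⟩ := is3Clique_iff_exists_cycle_length_three.mp ⟨s, hs⟩
  have h' := egirth_le_length hw
  rw [hlen] at h'
  exact absurd h' (not_le.mpr h)

theorem stmt17 {V : Type*} [Fintype V] (G : SimpleGraph V) [DecidableRel G.Adj]
    (hG : G.Connected)
    (hpath : ¬ ∃ n : ℕ, Nonempty (G ≃g pathGraph n))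
    (hcycle : ¬ ∃ n : ℕ, Nonempty (G ≃g cycleGraph n)) :
    (G.egirth = 3 → G.maxDegree ≤ 3 * resolvingNumber G - 4) ∧
    (3 < G.egirth → G.maxDegree ≤ resolvingNumber G) := by
  have := hG.nonempty
  obtain ⟨v, hv⟩ := G.exists_maximal_degree_vertex
  rw [hv]
  refine ⟨fun hg => ?_, fun hg => ?_⟩
  · rcases le_or_gt 3 (G.degree v) with h3 | h3
    · have := degree_add_four_le G v h3
      omega
    · have hcyc : ¬ G.IsAcyclic := fun h => by simp [egirth_eq_top.mpr h] at hg
      obtain ⟨a, w, hw, -⟩ := exists_egirth_eq_length.mpr hcyc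
      have h := card_lt_resolvingNumber G hw.snd_ne_penultimate {a} fun u hu => by
        obtain rfl := Finset.mem_singleton.mp hu
        rw [dist_eq_one_iff_adj.mpr (w.adj_snd hw.not_nil),
          dist_eq_one_iff_adj.mpr (w.adj_penultimate hw.not_nil).symm]
      rw [Finset.card_singleton] at h
      omega
  · rcases le_or_gt 2 (G.degree v) with h2 | h2
    · exact degree_le_resolvingNumber_of_cliqueFree G (cliqueFree_three_of_three_lt_egirth hg) v h2
    · rcases Nat.eq_zero_or_pos (G.degree v) with h0 | h0
      · omega
      · obtain ⟨w, hw⟩ := (G.degree_pos_iff_exists_adj v).mp h0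
        have := card_lt_resolvingNumber G hw.ne ∅ (by simp)
        omega
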